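/- Let t ≥ 4 be a natural number and let G be a finite simple graph that is P_t-free, bull-free and diamond-free. Then χ(G) ≤ max{2t − 4, ω(G)}. -/

import Mathlib

open SimpleGraph

/-- `G` is `H`-free: no induced subgraph of `G` is isomorphic to `H`. -/
def IsIndFree {V W : Type*} (G : SimpleGraph V) (H : SimpleGraph W) : Prop :=
  ∀ s : Set V, ¬ Nonempty (H ≃g G.induce s)

/-- The bull: a triangle with two pendant edges at distinct vertices. -/
def bull : SimpleGraph (Fin 5) :=
  SimpleGraph.fromEdgeSet {s(0,1), s(1,2), s(0,2), s(1,3), s(2,4)}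

/-- The diamond: `K₄` minus an edge. -/
def diamond : SimpleGraph (Fin 4) :=
  SimpleGraph.fromEdgeSet {s(0,2), s(0,3), s(1,2), s(1,3), s(2,3)}

/-- An injection that reflects and preserves adjacency contradicts `H`-freeness. -/
lemma IsIndFree.false_of_injective {V W : Type*} {G : SimpleGraph V} {H : SimpleGraph W}
    (h : IsIndFree G H) (f : W → V) (hf : Function.Injective f)
    (hadj : ∀ a b, G.Adj (f a) (f b) ↔ H.Adj a b) : False :=
  h (Set.range f) ⟨⟨Equiv.ofInjective f hf, by intro a b; simp [hadj]⟩⟩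

lemma IsIndFree.adj_of_diamond {V : Type*} {G : SimpleGraph V} (h : IsIndFree G diamond)
    {a b c d : V} (hab : G.Adj a b) (hac : G.Adj a c) (hbc : G.Adj b c)
    (hbd : G.Adj b d) (hcd : G.Adj c d) (had : a ≠ d) : G.Adj a d := by
  by_contra hn
  have := hab.ne; have := hac.ne; have := hbc.ne; have := hbd.ne; have := hcd.ne
  have h1 := hab.symm; have h2 := hac.symm; have h3 := hbc.symm
  have h4 := hbd.symm; have h5 := hcd.symm
  have hn' : ¬ G.Adj d a := fun h ↦ hn h.symm
  refine h.false_of_injective ![a, d, b, c] ?_ ?_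
  · intro i j hij
    fin_cases i <;> fin_cases j <;> simp_all
  · intro i j
    fin_cases i <;> fin_cases j <;> simp_all [diamond]

lemma IsIndFree.adj_of_bull {V : Type*} {G : SimpleGraph V} (h : IsIndFree G bull)
    {a b c x y : V} (hab : G.Adj a b) (hac : G.Adj a c) (hbc : G.Adj b c)
    (hax : G.Adj a x) (hby : G.Adj b y) (hbx : ¬ G.Adj b x) (hcx : ¬ G.Adj c x)
    (hay : ¬ G.Adj a y) (hcy : ¬ G.Adj c y) : G.Adj x y := by
  by_contra hn
  have := hab.ne; have := hac.ne; have := hbc.ne; have := hax.ne; have := hby.ne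
  have h1 := hab.symm; have h2 := hac.symm; have h3 := hbc.symm
  have h4 := hax.symm; have h5 := hby.symm
  have hn' : ¬ G.Adj y x := fun h ↦ hn h.symm
  have hbx' : ¬ G.Adj x b := fun h ↦ hbx h.symm
  have hcx' : ¬ G.Adj x c := fun h ↦ hcx h.symm
  have hay' : ¬ G.Adj y a := fun h ↦ hay h.symm
  have hcy' : ¬ G.Adj y c := fun h ↦ hcy h.symm
  have n1 : x ≠ y := by rintro rfl; exact hay hax
  have n2 : b ≠ x := by rintro rfl; exact hcx hbc.symm
  have n3 : c ≠ x := by rintro rfl; exact hbx hbc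
  have n4 : a ≠ y := by rintro rfl; exact hcy hac.symm
  have n5 : c ≠ y := by rintro rfl; exact hay hac
  refine h.false_of_injective ![c, a, b, x, y] ?_ ?_
  · intro i j hij
    fin_cases i <;> fin_cases j <;> simp_all
  · intro i j
    fin_cases i <;> fin_cases j <;> simp_all [bull]

/-- The subgraph induced on `S` has a proper colouring with colours `0, …, n - 1`. -/
def ColorableOn {V : Type*} (G : SimpleGraph V) (S : Set V) (n : ℕ) : Prop :=
  ∃ f : V → ℕ, (∀ x ∈ S, f x < n) ∧ ∀ x ∈ S, ∀ y ∈ S, G.Adj x y → f x ≠ f y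

/-- There are no edges between `D` and `C \ D`. -/
def NoEdgesOut {V : Type*} (G : SimpleGraph V) (C D : Set V) : Prop :=
  D ⊆ C ∧ ∀ x ∈ D, ∀ y ∈ C, G.Adj x y → y ∈ D

/-- No nonempty proper subset of `C` is separated from the rest of `C`. -/
def Indecomposable {V : Type*} (G : SimpleGraph V) (C : Set V) : Prop :=
  ∀ D, NoEdgesOut G C D → D.Nonempty → D = C

section

variable {V : Type*} {G : SimpleGraph V}

lemma ColorableOn.mono_right {S : Set V} {m n : ℕ} (h : ColorableOn G S m) (hmn : m ≤ n) :
    ColorableOn G S n := by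
  obtain ⟨f, hf, hp⟩ := h
  exact ⟨f, fun x hx ↦ (hf x hx).trans_le hmn, hp⟩

lemma nonempty_of_not_colorableOn {S : Set V} {n : ℕ} (h : ¬ ColorableOn G S n) :
    S.Nonempty := by
  by_contra hne
  rw [Set.not_nonempty_iff_eq_empty] at hne
  exact h ⟨fun _ ↦ 0, by simp [hne], by simp [hne]⟩

lemma ColorableOn.union_noEdges {C D : Set V} {n : ℕ} (hD : NoEdgesOut G C D)
    (h1 : ColorableOn G D n) (h2 : ColorableOn G (C \ D) n) : ColorableOn G C n := by
  classical
  obtain ⟨f, hf, hfp⟩ := h1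
  obtain ⟨g, hg, hgp⟩ := h2
  obtain ⟨-, hD⟩ := hD
  refine ⟨fun x ↦ if x ∈ D then f x else g x, fun x hx ↦ ?_, fun x hx y hy hxy ↦ ?_⟩
  · have := hf x
    have := fun h ↦ hg x ⟨hx, h⟩
    grind
  · have := fun h ↦ hD x h y hy hxy
    have := fun h ↦ hD y h x hx hxy.symm
    have := fun h h2 ↦ hfp x h y h2 hxy
    have := fun h h2 ↦ hgp x ⟨hx, h⟩ y ⟨hy, h2⟩ hxy
    grind

/-- One additional colour suffices for an additional independent set. -/
lemma ColorableOn.succ_of_diff {C I : Set V} {n : ℕ} (h : ColorableOn G (C \ I) n)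
    (hI : ∀ x ∈ C, ∀ y ∈ C, x ∈ I → y ∈ I → ¬ G.Adj x y) : ColorableOn G C (n + 1) := by
  classical
  obtain ⟨g, hg, hgp⟩ := h
  refine ⟨fun x ↦ if x ∈ I then n else g x, fun x hx ↦ ?_, fun x hx y hy hxy ↦ ?_⟩
  · have := fun h ↦ hg x ⟨hx, h⟩
    grind
  · have := hI x hx y hy
    have := fun h h2 ↦ hgp x ⟨hx, h⟩ y ⟨hy, h2⟩ hxy
    have := fun h ↦ hg x ⟨hx, h⟩
    have := fun h ↦ hg y ⟨hy, h⟩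
    grind

lemma exists_indecomposable_not_colorableOn [Finite V] {C : Set V} {n : ℕ}
    (h : ¬ ColorableOn G C n) :
    ∃ D, NoEdgesOut G C D ∧ Indecomposable G D ∧ ¬ ColorableOn G D n := by
  obtain ⟨D, -, hD⟩ := (Set.toFinite {D | NoEdgesOut G C D ∧ ¬ ColorableOn G D n}).exists_le_minimal
    (show C ∈ _ from ⟨⟨subset_rfl, fun _ _ _ h _ ↦ h⟩, h⟩)
  obtain ⟨⟨⟨hDC, hDe⟩, hDn⟩, hmin⟩ := hD
  refine ⟨D, ⟨hDC, hDe⟩, fun E ⟨hED, hEe⟩ ⟨e, he⟩ ↦ ?_, hDn⟩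
  by_contra hne
  obtain ⟨d, hd, hdE⟩ := Set.exists_of_ssubset (hED.ssubset_of_ne hne)
  have h1 : ColorableOn G E n := by
    by_contra hn
    refine hdE (hmin ⟨⟨hED.trans hDC, fun x hx y hy hxy ↦ ?_⟩, hn⟩ hED hd)
    exact hEe x hx y (hDe x (hED hx) y hy hxy) hxy
  have h2 : ColorableOn G (D \ E) n := by
    by_contra hn
    refine (hmin ⟨⟨Set.sdiff_subset.trans hDC, fun x hx y hy hxy ↦ ?_⟩, hn⟩
      Set.sdiff_subset (hED he)).2 he
    have hyD := hDe x hx.1 y hy hxy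
    exact ⟨hyD, fun hyE ↦ hx.2 (hEe y hyE x hx.1 hxy.symm)⟩
  exact hDn (h1.union_noEdges ⟨hED, hEe⟩ h2)

/-- The first `n` values of `p` form an induced path. -/
def IsIndPath (G : SimpleGraph V) (p : ℕ → V) (n : ℕ) : Prop :=
  ∀ i j, i < j → j < n → p i ≠ p j ∧ (G.Adj (p i) (p j) ↔ j = i + 1)

lemma IsIndFree.not_isIndPath {n : ℕ} (h : IsIndFree G (pathGraph n)) (p : ℕ → V) :
    ¬ IsIndPath G p n := by
  intro hp
  refine h.false_of_injective (fun i : Fin n ↦ p i) (fun i j hij ↦ ?_) (fun i j ↦ ?_)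
  · rcases lt_trichotomy i j with hlt | heq | hlt
    · exact absurd hij (hp i j hlt j.2).1
    · exact heq
    · exact absurd hij.symm (hp j i hlt i.2).1
  · rw [pathGraph_adj]
    rcases lt_trichotomy i j with hlt | rfl | hlt
    · rw [(hp i j hlt j.2).2]
      have : i.val < j.val := hlt
      omega
    · simp
    · rw [G.adj_comm, (hp j i hlt i.2).2]
      have : j.val < i.val := hlt
      omega

/-- Gyárfás' path argument for triangle-free graphs. -/
lemma exists_isIndPath_of_not_colorableOn [Finite V] (n : ℕ) :
    ∀ (C : Set V) (v : V), v ∉ C → (∃ u ∈ C, G.Adj v u) → Indecomposable G C →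
      (∀ x ∈ C, ∀ y ∈ C, ∀ z ∈ insert v C, G.Adj x y → G.Adj y z → ¬ G.Adj x z) →
      ¬ ColorableOn G C n →
      ∃ p : ℕ → V, p 0 = v ∧ (∀ i, 1 ≤ i → i < n + 2 → p i ∈ C) ∧ IsIndPath G p (n + 2) := by
  induction n with
  | zero =>
    rintro C v hv ⟨u, hu, hvu⟩ - - -
    refine ⟨fun i ↦ if i = 0 then v else u, rfl, fun i hi _ ↦ ?_, fun i j hij hj ↦ ?_⟩
    · simpa [show i ≠ 0 by omega] using hu
    · obtain ⟨rfl, rfl⟩ : i = 0 ∧ j = 1 := by omega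
      simpa using ⟨hvu.ne, hvu⟩
  | succ n ih =>
    rintro C v hv ⟨w, hw, hvw⟩ hC htri hcol
    have h1 : ¬ ColorableOn G (C \ {x | G.Adj v x}) n := fun h ↦ hcol <|
      h.succ_of_diff fun x hx y hy hvx hvy hxy ↦
        htri x hx y hy v (Set.mem_insert _ _) hxy (G.adj_symm hvy) (G.adj_symm hvx)
    obtain ⟨D, ⟨hDC, hDe⟩, hD, hDn⟩ := exists_indecomposable_not_colorableOn h1
    have hne : D.Nonempty := nonempty_of_not_colorableOn hDn
    obtain ⟨d, hd, u, hu, hdu, huD⟩ : ∃ d ∈ D, ∃ u ∈ C, G.Adj d u ∧ u ∉ D := by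
      by_contra! hcon
      have := hC D ⟨hDC.trans Set.sdiff_subset, hcon⟩ hne
      exact (hDC (this ▸ hw : w ∈ D)).2 hvw
    have hvu : G.Adj v u := by
      by_contra hvu
      exact huD (hDe d hd u ⟨hu, hvu⟩ hdu)
    obtain ⟨p, hp0, hpD, hp⟩ := ih D u huD ⟨d, hd, hdu.symm⟩ hD
      (fun x hx y hy z hz ↦ htri x (hDC hx).1 y (hDC hy).1 z <| Or.inr <| by
        rcases hz with rfl | hz
        exacts [hu, (hDC hz).1]) hDn
    have hpC : ∀ i, i < n + 2 → p i ∈ C := by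
      intro i hi
      rcases Nat.eq_zero_or_pos i with rfl | hi0
      · exact hp0 ▸ hu
      · exact (hDC (hpD i hi0 hi)).1
    refine ⟨fun i ↦ if i = 0 then v else p (i - 1), rfl, fun i hi hi' ↦ ?_, fun i j hij hj ↦ ?_⟩
    · simpa [show i ≠ 0 by omega] using hpC (i - 1) (by omega)
    · obtain ⟨j, rfl⟩ : ∃ j', j = j' + 1 := ⟨j - 1, by omega⟩
      rcases i with - | i
      · simp only [if_true, Nat.add_sub_cancel, Nat.succ_ne_zero, if_false]
        refine ⟨fun h ↦ hv (h ▸ hpC j (by omega)), ?_⟩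
        rcases Nat.eq_zero_or_pos j with rfl | hj0
        · simp [hp0, hvu]
        · exact ⟨fun h ↦ absurd h (hDC (hpD j hj0 (by omega))).2, by omega⟩
      · simpa using hp i j (by omega) (by omega)

lemma IsIndFree.colorableOn_of_triangleFree [Finite V] {n : ℕ}
    (h : IsIndFree G (pathGraph (n + 2))) {S : Set V}
    (htri : ∀ x ∈ S, ∀ y ∈ S, ∀ z ∈ S, G.Adj x y → G.Adj y z → ¬ G.Adj x z) :
    ColorableOn G S (n + 1) := by
  by_contra hS
  obtain ⟨D, ⟨hDS, -⟩, hD, hDn⟩ := exists_indecomposable_not_colorableOn hS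
  obtain ⟨v, hv⟩ : D.Nonempty := nonempty_of_not_colorableOn hDn
  have h1 : ¬ ColorableOn G (D \ {v}) n := fun h ↦ hDn <| h.succ_of_diff <| by
    rintro x - y - rfl rfl
    exact G.irrefl
  obtain ⟨C, ⟨hCD, hCe⟩, hC, hCn⟩ := exists_indecomposable_not_colorableOn h1
  have hvC : v ∉ C := fun h ↦ (hCD h).2 rfl
  have hatt : ∃ u ∈ C, G.Adj v u := by
    by_contra! hcon
    have hne : C.Nonempty := nonempty_of_not_colorableOn hCn
    refine hvC ((hD C ⟨hCD.trans Set.sdiff_subset, fun x hx y hy hxy ↦ ?_⟩ hne) ▸ hv)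
    exact hCe x hx y ⟨hy, by rintro rfl; exact hcon x hx hxy.symm⟩ hxy
  obtain ⟨p, -, -, hp⟩ := exists_isIndPath_of_not_colorableOn n C v hvC hatt hC
    (fun x hx y hy z hz ↦ htri x (hDS (hCD hx).1) y (hDS (hCD hy).1) z <| hDS <| by
      rcases hz with rfl | hz
      exacts [hv, (hCD hz).1]) hCn
  exact h.not_isIndPath p hp

/-- In a minimal non-`k`-colourable set `S`, every vertex of a clique `K` of size at most `k` has
a neighbour in `S` outside `K`. -/
lemma exists_adj_notMem_of_minimal {S : Set V} {k : ℕ} {K : Finset V}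
    (hS : Minimal (fun S ↦ ¬ ColorableOn G S k) S) (hKS : (K : Set V) ⊆ S) (hKk : K.card ≤ k)
    {a : V} (ha : a ∈ K) : ∃ x ∈ S, x ∉ K ∧ G.Adj a x := by
  classical
  by_contra! hcon
  have haS : a ∈ S := hKS ha
  obtain ⟨f, hf, hfp⟩ : ColorableOn G (S \ {a}) k := by
    by_contra hn
    exact (hS.2 hn Set.sdiff_subset haS).2 rfl
  obtain ⟨c, hc, hcK⟩ : ∃ c ∈ Finset.range k, c ∉ (K.erase a).image f := by
    refine Finset.exists_mem_notMem_of_card_lt_card ?_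
    have h1 := Finset.card_image_le (s := K.erase a) (f := f)
    have h2 := Finset.card_erase_lt_of_mem ha
    rw [Finset.card_range]
    omega
  rw [Finset.mem_range] at hc
  have key : ∀ x ∈ S, G.Adj a x → f x ≠ c := by
    rintro x hx hax rfl
    refine hcK (Finset.mem_image_of_mem f (Finset.mem_erase.2 ⟨hax.ne', ?_⟩))
    by_contra hxK
    exact hcon x hx hxK hax
  refine hS.1 ⟨fun x ↦ if x = a then c else f x, fun x hx ↦ ?_, fun x hx y hy hxy ↦ ?_⟩
  · have := fun h ↦ hf x ⟨hx, h⟩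
    grind
  · have := hxy.ne
    have := fun h h2 ↦ hfp x ⟨hx, h⟩ y ⟨hy, h2⟩ hxy
    have := key x hx
    have := key y hy
    have := hxy.symm
    grind

/-- A colouring extends to a clique whose vertices have unique, pairwise adjacent outer
neighbours: shift the colours of those neighbours cyclically. -/
lemma ColorableOn.of_diff_clique {S K : Set V} {k : ℕ} (hk : 2 ≤ k)
    (h : ColorableOn G (S \ K) k) (x : V → V) (hxS : ∀ a ∈ K, x a ∈ S \ K)
    (hx : ∀ a ∈ K, ∀ y ∈ S \ K, G.Adj a y → y = x a)
    (hadj : ∀ a ∈ K, ∀ b ∈ K, a ≠ b → G.Adj (x a) (x b)) : ColorableOn G S k := by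
  classical
  obtain ⟨f, hf, hfp⟩ := h
  let σ : ℕ → ℕ := fun c ↦ if c + 1 = k then 0 else c + 1
  have σ_lt : ∀ c < k, σ c < k := by grind
  have σ_ne : ∀ c < k, σ c ≠ c := by grind
  have σ_inj : ∀ c < k, ∀ d < k, σ c = σ d → c = d := by grind
  have hcross : ∀ a ∈ K, ∀ y ∈ S \ K, G.Adj a y → σ (f (x a)) ≠ f y := by
    intro a ha y hy hay
    rw [hx a ha y hy hay]
    exact σ_ne _ (hf _ (hxS a ha))
  refine ⟨fun a ↦ if a ∈ K then σ (f (x a)) else f a, fun a ha ↦ ?_, fun a ha b hb hab ↦ ?_⟩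
  · by_cases haK : a ∈ K
    · simpa [haK] using σ_lt _ (hf _ (hxS a haK))
    · simpa [haK] using hf a ⟨ha, haK⟩
  · by_cases haK : a ∈ K <;> by_cases hbK : b ∈ K <;> simp only [haK, hbK, if_true, if_false]
    · intro heq
      exact hfp _ (hxS a haK) _ (hxS b hbK) (hadj a haK b hbK hab.ne)
        (σ_inj _ (hf _ (hxS a haK)) _ (hf _ (hxS b hbK)) heq)
    · exact hcross a haK b ⟨hb, hbK⟩ hab
    · exact (hcross b hbK a ⟨ha, haK⟩ hab.symm).symm
    · exact hfp a ⟨ha, haK⟩ b ⟨hb, hbK⟩ hab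

/-- A minimal non-`k`-colourable set of a (bull, diamond)-free graph without cliques on more than
`k ≥ 2` vertices is triangle-free. -/
lemma not_adj_of_minimal_not_colorableOn [Finite V] (hGb : IsIndFree G bull)
    (hGd : IsIndFree G diamond) {k : ℕ} (hk : 2 ≤ k)
    (hclique : ∀ K : Finset V, G.IsClique K → K.card ≤ k) {S : Set V}
    (hS : Minimal (fun S ↦ ¬ ColorableOn G S k) S) {u v w : V} (hu : u ∈ S) (hv : v ∈ S)
    (hw : w ∈ S) (huv : G.Adj u v) (hvw : G.Adj v w) : ¬ G.Adj u w := by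
  classical
  intro huw
  have := Fintype.ofFinite V
  have hT : ({u, v, w} : Finset V) ∈ {K : Finset V | G.IsClique K ∧ (K : Set V) ⊆ S} := by
    refine ⟨?_, ?_⟩
    · simp [huv, hvw, huw]
    · simp [Set.insert_subset_iff, hu, hv, hw]
  obtain ⟨K, hTK, ⟨hK, hKS⟩, hmax⟩ := (Set.toFinite _).exists_le_maximal hT
  have hthird : ∀ a b : V, ∃ c ∈ K, c ≠ a ∧ c ≠ b := by
    intro a b
    have hcard : ({a, b} : Finset V).card < K.card := by
      have h1 : ({u, v, w} : Finset V).card = 3 :=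
        Finset.card_eq_three.2 ⟨u, v, w, huv.ne, huw.ne, hvw.ne, rfl⟩
      have h2 := Finset.card_le_card hTK
      have h3 := Finset.card_le_two (a := a) (b := b)
      omega
    obtain ⟨c, hc, hcn⟩ := Finset.exists_mem_notMem_of_card_lt_card hcard
    simp only [Finset.mem_insert, Finset.mem_singleton, not_or] at hcn
    exact ⟨c, hc, hcn⟩
  have hone : ∀ y ∈ S, y ∉ K → ∀ a ∈ K, ∀ b ∈ K, a ≠ b → G.Adj a y → ¬ G.Adj b y := by
    intro y hyS hyK a ha b hb hab hay hby
    refine hyK (hmax (y := insert y K) ⟨?_, ?_⟩ (Finset.subset_insert _ _)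
      (Finset.mem_insert_self _ _))
    · rw [Finset.coe_insert, isClique_insert]
      refine ⟨hK, fun c hc hyc ↦ ?_⟩
      by_cases hca : c = a
      · exact hca ▸ hay.symm
      by_cases hcb : c = b
      · exact hcb ▸ hby.symm
      exact (hGd.adj_of_diamond (hK hc ha hca) (hK hc hb hcb) (hK ha hb hab) hay hby hyc.symm).symm
    · rw [Finset.coe_insert]
      exact Set.insert_subset hyS hKS
  have hout : ∀ a ∈ K, ∃ y ∈ S, y ∉ K ∧ G.Adj a y := fun a ha ↦
    exists_adj_notMem_of_minimal hS hKS (hclique K hK) ha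
  have hjoin : ∀ a ∈ K, ∀ b ∈ K, a ≠ b → ∀ y ∈ S, y ∉ K → ∀ z ∈ S, z ∉ K →
      G.Adj a y → G.Adj b z → G.Adj y z := by
    intro a ha b hb hab y hyS hyK z hzS hzK hay hbz
    obtain ⟨c, hc, hca, hcb⟩ := hthird a b
    exact hGb.adj_of_bull (hK ha hb hab) (hK ha hc hca.symm) (hK hb hc hcb.symm) hay hbz
      (hone y hyS hyK a ha b hb hab hay) (hone y hyS hyK a ha c hc hca.symm hay)
      (hone z hzS hzK b hb a ha hab.symm hbz) (hone z hzS hzK b hb c hc hcb.symm hbz)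
  choose! x hxS hxK hax using hout
  have huniq : ∀ a ∈ K, ∀ y ∈ S \ (K : Set V), G.Adj a y → y = x a := by
    rintro a ha y ⟨hyS, hyK⟩ hay
    by_contra hne
    obtain ⟨b, hb, hba, -⟩ := hthird a a
    obtain ⟨c, hc, hca, hcb⟩ := hthird a b
    have j : ∀ d ∈ K, d ≠ a → G.Adj y (x d) ∧ G.Adj (x a) (x d) := fun d hd hda ↦
      ⟨hjoin a ha d hd hda.symm _ hyS hyK _ (hxS d hd) (hxK d hd) hay (hax d hd),
        hjoin a ha d hd hda.symm _ (hxS a ha) (hxK a ha) _ (hxS d hd) (hxK d hd) (hax a ha)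
          (hax d hd)⟩
    have hbc : G.Adj (x b) (x c) := hjoin b hb c hc hcb.symm _ (hxS b hb) (hxK b hb) _ (hxS c hc)
      (hxK c hc) (hax b hb) (hax c hc)
    have hyx : G.Adj y (x a) := hGd.adj_of_diamond (j b hb hba).1 (j c hc hca).1 hbc
      (j b hb hba).2.symm (j c hc hca).2.symm hne
    have : G.Adj a (x b) := hGd.adj_of_diamond hay (hax a ha) hyx (j b hb hba).1 (j b hb hba).2
      (by rintro h; exact hxK b hb (h ▸ ha))
    exact hone _ (hxS b hb) (hxK b hb) b hb a ha hba (hax b hb) this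
  have hdiff : ColorableOn G (S \ K) k := by
    by_contra hn
    obtain ⟨c, hc, -⟩ := hthird u u
    exact (hS.2 hn Set.sdiff_subset (hKS hc)).2 hc
  exact hS.1 <| hdiff.of_diff_clique hk x (fun a ha ↦ ⟨hxS a ha, hxK a ha⟩) huniq
    fun a ha b hb hab ↦ hjoin a ha b hb hab _ (hxS a ha) (hxK a ha) _ (hxS b hb) (hxK b hb)
      (hax a ha) (hax b hb)

lemma ColorableOn.colorable {k : ℕ} (h : ColorableOn G Set.univ k) : G.Colorable k := by
  obtain ⟨f, hf, hfp⟩ := h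
  exact ⟨Coloring.mk (fun v ↦ ⟨f v, hf v trivial⟩) fun {a b} hab heq ↦
    hfp a trivial b trivial hab (congrArg Fin.val heq)⟩

end

theorem statement_3 (t : ℕ) (ht : 4 ≤ t) {V : Type*} [Fintype V] (G : SimpleGraph V)
    (hGp : IsIndFree G (pathGraph t)) (hGb : IsIndFree G bull)
    (hGd : IsIndFree G diamond) :
    G.chromaticNumber ≤ (max (2 * t - 4) G.cliqueNum : ℕ∞) := by
  have hcol : G.Colorable (max (2 * t - 4) G.cliqueNum) := by
    refine ColorableOn.colorable ?_
    by_contra hn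
    obtain ⟨S, -, hS⟩ := (Set.toFinite
      {S | ¬ ColorableOn G S (max (2 * t - 4) G.cliqueNum)}).exists_le_minimal hn
    obtain ⟨n, rfl⟩ : ∃ n, t = n + 2 := ⟨t - 2, by omega⟩
    refine hS.1 (ColorableOn.mono_right (hGp.colorableOn_of_triangleFree ?_) (m := n + 1) ?_)
    · exact fun x hx y hy z hz ↦ not_adj_of_minimal_not_colorableOn hGb hGd (by omega)
        (fun K hK ↦ (IsClique.card_le_cliqueNum (tc := hK)).trans (le_max_right _ _)) hS hx hy hz
    · omega
  exact hcol.chromaticNumber_le
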